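/- There exist constants c₁, c₂ > 0 depending only on the dimension d such that: for every finite set X ⊂ ℝᵈ of pairwise distinct points with separation distance q_X = min_{x_i ≠ x_j ∈ X} ‖x_i − x_j‖, every R ≥ √2 λ_min(−Δ)^{1/2} / q_X (where λ_min(−Δ) is the smallest Dirichlet eigenvalue of the Laplacian on the ball B_{1/2}(0) ⊂ ℝᵈ), every x₀ ∈ ℝᵈ and every α ∈ ℝ^{|X|}, one has c₁ Rᵈ ‖α‖² ≤ ∫_{B_R(x₀)} |Σ_j α_j e^{i ωᵀx_j}|² dω ≤ c₂ Rᵈ ‖α‖², and moreover the upper bound already holds whenever R ≥ π/q_X. -/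

import Mathlib

open MeasureTheory
open scoped InnerProductSpace

/-- The smallest eigenvalue of the Dirichlet Laplace operator on the ball
`B_{1/2}(0) ⊂ ℝ^d`, via its variational (Rayleigh quotient) characterization. -/
noncomputable def dirichletLambdaMin (d : ℕ) : ℝ :=
  ⨅ u : {u : EuclideanSpace ℝ (Fin d) → ℝ //
      ContDiff ℝ 2 u ∧ tsupport u ⊆ Metric.ball 0 (1 / 2) ∧ (∫ x, u x ^ 2) ≠ 0},
    (∫ x, ‖fderiv ℝ u.1 x‖ ^ 2) / ∫ x, u.1 x ^ 2

open scoped FourierTransform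

lemma plancherel_cc {d : ℕ} (f : EuclideanSpace ℝ (Fin d) → ℂ) (hf : Continuous f)
    (hs : HasCompactSupport f) :
    Integrable (fun ξ => ‖𝓕 f ξ‖ ^ 2) ∧ ∫ ξ, ‖𝓕 f ξ‖ ^ 2 = ∫ x, ‖f x‖ ^ 2 := by
  have hfi : Integrable f := hf.integrable_of_hasCompactSupport hs
  have hm : MemLp f 2 := hf.memLp_of_hasCompactSupport hs
  set F : Lp ℂ 2 (volume : Measure (EuclideanSpace ℝ (Fin d))) := hm.toLp f with hF
  have hFf : (F : EuclideanSpace ℝ (Fin d) → ℂ) =ᵐ[volume] f := hm.coeFn_toLp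
  set G : Lp ℂ 2 (volume : Measure (EuclideanSpace ℝ (Fin d))) := 𝓕 F with hG
  have hcont : Continuous (𝓕 f) :=
    VectorFourier.fourierIntegral_continuous Real.continuous_fourierChar
      (by exact continuous_inner) hfi
  have hGf : ∀ᵐ x, (G : EuclideanSpace ℝ (Fin d) → ℂ) x = 𝓕 f x := by
    apply ae_eq_of_integral_contDiff_smul_eq
    · exact (Lp.memLp G).locallyIntegrable (by norm_num)
    · exact hcont.locallyIntegrable
    · intro g hg hgs
      have hg1 : ContDiff ℝ (⊤ : ℕ∞) (fun x => (g x : ℂ)) := Complex.ofRealCLM.contDiff.comp hg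
      have hg2 : HasCompactSupport (fun x => (g x : ℂ)) :=
        hgs.comp_left (g := fun x : ℝ => (x : ℂ)) (by simp)
      set φ := hg2.toSchwartzMap hg1 with hφ
      have hφg : ∀ x, φ x = (g x : ℂ) := fun x => rfl
      have e := congrArg (fun T => T φ) (Lp.fourier_toTemperedDistribution_eq F)
      simp only [TemperedDistribution.fourier_apply, Lp.toTemperedDistribution_apply] at e
      have e1 : ∫ x, (𝓕 φ) x • F x = ∫ x, (𝓕 φ) x • f x := by
        apply integral_congr_ae
        filter_upwards [hFf] with x hx
        rw [hx]
      have e2 : ∫ x, (𝓕 φ) x • f x = ∫ x, φ x • 𝓕 f x := by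
        have := VectorFourier.integral_fourierIntegral_smul_eq_flip (μ := volume) (ν := volume)
          (L := innerₗ (EuclideanSpace ℝ (Fin d))) (f := φ) (g := f) Real.continuous_fourierChar
          (by exact continuous_inner) φ.integrable hfi
        rw [flip_innerₗ] at this
        exact this
      have e3 : ∫ x, φ x • G x = ∫ x, φ x • 𝓕 f x := by
        rw [← e2, ← e1, e]
      simpa [hφg] using e3
  have hmG : MemLp (𝓕 f) 2 := (memLp_congr_ae hGf).1 (Lp.memLp G)
  refine ⟨(memLp_two_iff_integrable_sq_norm hcont.aestronglyMeasurable).1 hmG, ?_⟩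
  have hn : ‖G‖ = ‖F‖ := Lp.norm_fourier_eq F
  have key : ∀ H : Lp ℂ 2 (volume : Measure (EuclideanSpace ℝ (Fin d))), ‖H‖ ^ 2 = ∫ x, ‖H x‖ ^ 2 := by
    intro H
    have h1 : ((‖H‖ ^ 2 : ℝ) : ℂ) = ((∫ x, ‖H x‖ ^ 2 : ℝ) : ℂ) := by
      have := inner_self_eq_norm_sq_to_K (𝕜 := ℂ) H
      rw [L2.inner_def] at this
      simp only [inner_self_eq_norm_sq_to_K] at this
      rw [← integral_complex_ofReal]
      push_cast
      exact this.symm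
    exact_mod_cast h1
  calc ∫ ξ, ‖𝓕 f ξ‖ ^ 2 = ∫ ξ, ‖G ξ‖ ^ 2 := by
        apply integral_congr_ae; filter_upwards [hGf] with x hx; rw [hx]
    _ = ∫ x, ‖F x‖ ^ 2 := by rw [← key, ← key, hn]
    _ = _ := by apply integral_congr_ae; filter_upwards [hFf] with x hx; rw [hx]

lemma fourier_shift {d n : ℕ} (v : EuclideanSpace ℝ (Fin d) → ℂ) (hv : Integrable v)
    (y : Fin n → EuclideanSpace ℝ (Fin d)) (β : Fin n → ℂ) (ξ : EuclideanSpace ℝ (Fin d)) :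
    𝓕 (fun x => ∑ j, β j * v (x + y j)) ξ =
      𝓕 v ξ * ∑ j, β j * Complex.exp (Complex.I * ((2 * Real.pi * ⟪ξ, y j⟫_ℝ : ℝ) : ℂ)) := by
  have h1 : ∀ j, 𝓕 (fun x => v (x + y j)) ξ =
      Complex.exp (Complex.I * ((2 * Real.pi * ⟪ξ, y j⟫_ℝ : ℝ) : ℂ)) * 𝓕 v ξ := by
    intro j
    have := congrFun (VectorFourier.fourierIntegral_comp_add_right Real.fourierChar volume
      (innerₗ (EuclideanSpace ℝ (Fin d))) v (y j)) ξ
    refine Eq.trans this ?_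
    simp only [innerₗ_apply_apply, Circle.smul_def, Real.fourierChar_apply, smul_eq_mul]
    rw [real_inner_comm]
    congr 2
    push_cast; ring
  have h2 : ∀ j, Integrable (fun x => Real.fourierChar (-⟪x, ξ⟫_ℝ) • (β j * v (x + y j))) := by
    intro j
    have hi : Integrable (fun x => β j * v (x + y j)) := (hv.comp_add_right (y j)).const_mul _
    exact (Real.fourierIntegral_convergent_iff ξ).2 hi
  rw [Real.fourier_eq]
  simp only [Finset.smul_sum]
  rw [integral_finsetSum _ (fun j _ => h2 j), Finset.mul_sum]
  refine Finset.sum_congr rfl fun j _ => ?_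
  have h3 := h1 j
  rw [Real.fourier_eq] at h3
  calc _ = ∫ x, β j * (Real.fourierChar (-⟪x, ξ⟫_ℝ) • v (x + y j)) := by
        congr 1; ext x; simp only [Circle.smul_def, smul_eq_mul]; ring
    _ = _ := by rw [integral_const_mul, h3]; ring

lemma key_one {d n : ℕ} (v : EuclideanSpace ℝ (Fin d) → ℝ) (hv : Continuous v)
    (hs : tsupport v ⊆ Metric.ball 0 (1 / 2))
    (y : Fin n → EuclideanSpace ℝ (Fin d)) (hy : ∀ i j, i ≠ j → 1 ≤ dist (y i) (y j))
    (β : Fin n → ℂ) :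
    Integrable (fun ξ => ‖𝓕 (fun x => (v x : ℂ)) ξ‖ ^ 2 *
      ‖∑ j, β j * Complex.exp (Complex.I * ((2 * Real.pi * ⟪ξ, y j⟫_ℝ : ℝ) : ℂ))‖ ^ 2) ∧
    ∫ ξ, ‖𝓕 (fun x => (v x : ℂ)) ξ‖ ^ 2 *
      ‖∑ j, β j * Complex.exp (Complex.I * ((2 * Real.pi * ⟪ξ, y j⟫_ℝ : ℝ) : ℂ))‖ ^ 2
      = (∫ x, v x ^ 2) * ∑ j, ‖β j‖ ^ 2 := by
  have hc : HasCompactSupport v :=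
    HasCompactSupport.of_support_subset_isCompact (isCompact_closedBall 0 (1 / 2))
      ((subset_tsupport v).trans (hs.trans Metric.ball_subset_closedBall))
  have hcC : HasCompactSupport (fun x => (v x : ℂ)) :=
    hc.comp_left (g := fun x : ℝ => (x : ℂ)) (by simp)
  have hvC : Continuous (fun x => (v x : ℂ)) := Complex.continuous_ofReal.comp hv
  have hsh : ∀ j, HasCompactSupport (fun x => v (x + y j)) := fun j =>
    hc.comp_homeomorph (Homeomorph.addRight (y j))
  have hshC : ∀ j, HasCompactSupport (fun x => (v (x + y j) : ℂ)) := fun j =>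
    hcC.comp_homeomorph (Homeomorph.addRight (y j))
  have hFc : Continuous (fun x => ∑ j, β j * (v (x + y j) : ℂ)) := by fun_prop
  have hFs : HasCompactSupport (fun x => ∑ j, β j * (v (x + y j) : ℂ)) := by
    have : ∀ s : Finset (Fin n), HasCompactSupport (fun x => ∑ j ∈ s, β j * (v (x + y j) : ℂ)) := by
      intro s
      classical
      induction s using Finset.induction_on with
      | empty => simp only [Finset.sum_empty]; exact HasCompactSupport.zero
      | insert a s ha ih =>
        simp only [Finset.sum_insert ha]
        exact ((hshC a).mul_left).add ih
    exact this _
  obtain ⟨p1, p2⟩ := plancherel_cc _ hFc hFs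
  have hfs := fourier_shift _ (hvC.integrable_of_hasCompactSupport hcC) y β
  have hpt : ∀ x, ‖∑ j, β j * (v (x + y j) : ℂ)‖ ^ 2 = ∑ j, ‖β j‖ ^ 2 * v (x + y j) ^ 2 := by
    intro x
    by_cases h : ∃ j, v (x + y j) ≠ 0
    · obtain ⟨j, hj⟩ := h
      have hz : ∀ i, i ≠ j → v (x + y i) = 0 := by
        intro i hij
        by_contra hi
        have a1 := hs (subset_tsupport v hj)
        have a2 := hs (subset_tsupport v hi)
        rw [Metric.mem_ball] at a1 a2
        have a3 := hy i j hij
        have a4 := dist_triangle_right (x + y i) (x + y j) 0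
        rw [dist_add_left] at a4
        linarith
      rw [Finset.sum_eq_single j (fun i _ hi => by simp [hz i hi]) (by simp),
        Finset.sum_eq_single j (fun i _ hi => by simp [hz i hi]) (by simp)]
      simp [mul_pow]
    · push Not at h
      simp [h]
  simp only [hfs, norm_mul, mul_pow] at p1 p2
  refine ⟨p1, p2.trans ?_⟩
  simp only [hpt]
  rw [integral_finsetSum]
  · simp only [integral_const_mul]
    rw [Finset.mul_sum]
    refine Finset.sum_congr rfl fun j _ => ?_
    rw [integral_add_right_eq_self (fun x => v x ^ 2) (y j)]
    ring
  · intro j _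
    refine Integrable.const_mul ?_ _
    refine Continuous.integrable_of_hasCompactSupport (by fun_prop) ?_
    simp only [pow_two]
    exact (hsh j).mul_left

lemma norm_dual_sq {d : ℕ} (L : EuclideanSpace ℝ (Fin d) →L[ℝ] ℝ) :
    ‖L‖ ^ 2 = ∑ i, (L (EuclideanSpace.single i 1)) ^ 2 := by
  set w := (InnerProductSpace.toDual ℝ (EuclideanSpace ℝ (Fin d))).symm L with hw
  have h1 : ‖L‖ = ‖w‖ := by simp [hw]
  have h2 : ∀ z, L z = ⟪w, z⟫_ℝ := fun z => by simp [hw]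
  rw [h1, EuclideanSpace.norm_sq_eq]
  simp [h2, EuclideanSpace.inner_single_right]

lemma tsupport_fderiv_apply_subset' {d : ℕ} (u : EuclideanSpace ℝ (Fin d) → ℝ)
    (e : EuclideanSpace ℝ (Fin d)) : tsupport (fun x => fderiv ℝ u x e) ⊆ tsupport u := by
  refine (closure_mono ?_).trans (tsupport_fderiv_subset ℝ (f := u))
  intro x hx
  rw [Function.mem_support] at hx ⊢
  intro h
  simp [h] at hx

lemma fourier_partial {d : ℕ} (u : EuclideanSpace ℝ (Fin d) → ℝ) (hu : ContDiff ℝ 2 u)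
    (hc : HasCompactSupport u) (i : Fin d) (ξ : EuclideanSpace ℝ (Fin d)) :
    𝓕 (fun x => ((fderiv ℝ u x (EuclideanSpace.single i 1) : ℝ) : ℂ)) ξ =
      (2 * Real.pi * Complex.I * (ξ i : ℂ)) * 𝓕 (fun x => (u x : ℂ)) ξ := by
  set U : EuclideanSpace ℝ (Fin d) → ℂ := fun x => (u x : ℂ) with hU
  have hUd : ContDiff ℝ 2 U := Complex.ofRealCLM.contDiff.comp hu
  have hUc : HasCompactSupport U := hc.comp_left (g := fun x : ℝ => (x : ℂ)) (by simp)
  have hi' : Integrable (fderiv ℝ U) :=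
    (hUd.continuous_fderiv (by norm_num)).integrable_of_hasCompactSupport (hUc.fderiv ℝ)
  have h := Real.fourier_fderiv (hUd.continuous.integrable_of_hasCompactSupport hUc)
    (hUd.differentiable (by norm_num)) hi'
  have h2 := congrArg (fun L => L (EuclideanSpace.single i 1)) (congrFun h ξ)
  simp only [VectorFourier.fourierSMulRight_apply] at h2
  rw [Real.fourier_continuousLinearMap_apply hi'] at h2
  have h3 : (fun x => ((fderiv ℝ u x (EuclideanSpace.single i 1) : ℝ) : ℂ)) =
      fun x => fderiv ℝ U x (EuclideanSpace.single i 1) := by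
    ext x
    have := (Complex.ofRealCLM.hasFDerivAt.comp x
      ((hu.differentiable (by norm_num)) x).hasFDerivAt).fderiv
    have e : U = (⇑Complex.ofRealCLM ∘ u) := rfl
    rw [e, this]; simp
  rw [h3, h2]
  have h4 : (innerSL ℝ ξ) (EuclideanSpace.single i (1 : ℝ)) = ξ i := by
    rw [innerSL_apply_apply]; simp [EuclideanSpace.inner_single_right]
  simp [h4]
  ring

lemma key_two {d n : ℕ} (u : EuclideanSpace ℝ (Fin d) → ℝ) (hu : ContDiff ℝ 2 u)
    (hs : tsupport u ⊆ Metric.ball 0 (1 / 2))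
    (y : Fin n → EuclideanSpace ℝ (Fin d)) (hy : ∀ i j, i ≠ j → 1 ≤ dist (y i) (y j))
    (β : Fin n → ℂ) :
    Integrable (fun ξ => (2 * Real.pi * ‖ξ‖) ^ 2 * (‖𝓕 (fun x => (u x : ℂ)) ξ‖ ^ 2 *
      ‖∑ j, β j * Complex.exp (Complex.I * ((2 * Real.pi * ⟪ξ, y j⟫_ℝ : ℝ) : ℂ))‖ ^ 2)) ∧
    ∫ ξ, (2 * Real.pi * ‖ξ‖) ^ 2 * (‖𝓕 (fun x => (u x : ℂ)) ξ‖ ^ 2 *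
      ‖∑ j, β j * Complex.exp (Complex.I * ((2 * Real.pi * ⟪ξ, y j⟫_ℝ : ℝ) : ℂ))‖ ^ 2)
      = (∫ x, ‖fderiv ℝ u x‖ ^ 2) * ∑ j, ‖β j‖ ^ 2 := by
  have hc : HasCompactSupport u :=
    HasCompactSupport.of_support_subset_isCompact (isCompact_closedBall 0 (1 / 2))
      ((subset_tsupport u).trans (hs.trans Metric.ball_subset_closedBall))
  have hcont : ∀ i : Fin d, Continuous (fun x => fderiv ℝ u x (EuclideanSpace.single i 1)) :=
    fun i => (hu.continuous_fderiv (by norm_num)).clm_apply continuous_const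
  have K := fun i : Fin d => key_one (fun x => fderiv ℝ u x (EuclideanSpace.single i 1))
    (hcont i) ((tsupport_fderiv_apply_subset' u _).trans hs) y hy β
  simp only [fourier_partial u hu hc] at K
  have hpt : ∀ ξ : EuclideanSpace ℝ (Fin d), (2 * Real.pi * ‖ξ‖) ^ 2 * (‖𝓕 (fun x => (u x : ℂ)) ξ‖ ^ 2 *
      ‖∑ j, β j * Complex.exp (Complex.I * ((2 * Real.pi * ⟪ξ, y j⟫_ℝ : ℝ) : ℂ))‖ ^ 2) =
      ∑ i : Fin d, ‖2 * Real.pi * Complex.I * (ξ i : ℂ) * 𝓕 (fun x => (u x : ℂ)) ξ‖ ^ 2 *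
      ‖∑ j, β j * Complex.exp (Complex.I * ((2 * Real.pi * ⟪ξ, y j⟫_ℝ : ℝ) : ℂ))‖ ^ 2 := by
    intro ξ
    rw [mul_pow, EuclideanSpace.norm_sq_eq, ← Finset.sum_mul, ← mul_assoc]
    congr 1
    rw [Finset.mul_sum, Finset.sum_mul]
    refine Finset.sum_congr rfl fun i _ => ?_
    simp [mul_pow]
  simp only [hpt]
  refine ⟨integrable_finsetSum _ fun i _ => (K i).1, ?_⟩
  rw [integral_finsetSum _ fun i _ => (K i).1]
  simp only [norm_dual_sq]
  rw [integral_finsetSum, Finset.sum_mul]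
  · exact Finset.sum_congr rfl fun i _ => (K i).2
  · intro i _
    refine Continuous.integrable_of_hasCompactSupport ((hcont i).pow 2) ?_
    have : HasCompactSupport (fun x => fderiv ℝ u x (EuclideanSpace.single i 1)) :=
      HasCompactSupport.of_support_subset_isCompact hc
        ((subset_tsupport _).trans (tsupport_fderiv_apply_subset' u _))
    simp only [pow_two]
    exact this.mul_left

lemma poincare {d : ℕ} (i : Fin d) (u : EuclideanSpace ℝ (Fin d) → ℝ) (hu : ContDiff ℝ 2 u)
    (hs : tsupport u ⊆ Metric.ball 0 (1 / 2)) :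
    ∫ x, u x ^ 2 ≤ ∫ x, ‖fderiv ℝ u x‖ ^ 2 := by
  have hc : HasCompactSupport u :=
    HasCompactSupport.of_support_subset_isCompact (isCompact_closedBall 0 (1 / 2))
      ((subset_tsupport u).trans (hs.trans Metric.ball_subset_closedBall))
  set e : EuclideanSpace ℝ (Fin d) := EuclideanSpace.single i 1 with he
  have hdu : Differentiable ℝ u := hu.differentiable (by norm_num)
  have hcu : Continuous u := hu.continuous
  have hcd : Continuous (fun x => fderiv ℝ u x e) :=
    (hu.continuous_fderiv (by norm_num)).clm_apply continuous_const
  have hcf : Continuous (fun x => ‖fderiv ℝ u x‖ ^ 2) :=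
    ((hu.continuous_fderiv (by norm_num)).norm).pow 2
  have hci : Continuous (fun x : EuclideanSpace ℝ (Fin d) => x i) := by fun_prop
  have hiu : Integrable (fun x => u x ^ 2) := by
    refine Continuous.integrable_of_hasCompactSupport (by fun_prop) ?_
    simp only [pow_two]; exact hc.mul_left
  have hif : Integrable (fun x => ‖fderiv ℝ u x‖ ^ 2) := by
    refine Continuous.integrable_of_hasCompactSupport hcf ?_
    simp only [pow_two]; exact ((hc.fderiv ℝ).norm).mul_left
  have hixu : Integrable (fun x => x i * u x * fderiv ℝ u x e) := by
    refine Continuous.integrable_of_hasCompactSupport ((hci.mul hcu).mul hcd) ?_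
    exact (hc.mul_left).mul_right
  have hder : ∀ x, fderiv ℝ (fun x => x i * u x) x e = u x + x i * fderiv ℝ u x e := by
    intro x
    have h1 : HasFDerivAt (fun x : EuclideanSpace ℝ (Fin d) => x i)
        (EuclideanSpace.proj i : EuclideanSpace ℝ (Fin d) →L[ℝ] ℝ) x :=
      (EuclideanSpace.proj i : EuclideanSpace ℝ (Fin d) →L[ℝ] ℝ).hasFDerivAt
    have h2 := (h1.mul (hdu x).hasFDerivAt).fderiv
    refine (congrArg (fun L => L e) h2).trans ?_
    simp [he]; ring
  have hdx : Differentiable ℝ (fun x : EuclideanSpace ℝ (Fin d) => x i * u x) :=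
    fun x => ((EuclideanSpace.proj i : EuclideanSpace ℝ (Fin d) →L[ℝ] ℝ).differentiableAt).mul (hdu x)
  have hI := integral_mul_fderiv_eq_neg_fderiv_mul_of_integrable (μ := volume)
    (f := fun x : EuclideanSpace ℝ (Fin d) => x i * u x) (g := u) (v := e)
    (by
      simp only [hder]
      refine (hiu.add hixu).congr (Filter.Eventually.of_forall fun x => ?_)
      simp only [Pi.add_apply]; ring) hixu
    (by
      refine Continuous.integrable_of_hasCompactSupport ((hci.mul hcu).mul hcu) ?_
      exact hc.mul_left) (fun x _ => hdx x) (fun x _ => hdu x)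
  simp only [hder] at hI
  have hI2 : ∫ x, (u x + x i * fderiv ℝ u x e) * u x =
      (∫ x, u x ^ 2) + ∫ x, x i * u x * fderiv ℝ u x e := by
    rw [← integral_add hiu hixu]
    congr 1; ext x; ring
  rw [hI2] at hI
  have hI3 : -(∫ x, x i * u x * fderiv ℝ u x e) ≤
      (1 / 4) * (∫ x, u x ^ 2) + (1 / 4) * ∫ x, ‖fderiv ℝ u x‖ ^ 2 := by
    rw [← integral_neg, ← integral_const_mul, ← integral_const_mul,
      ← integral_add (hiu.const_mul _) (hif.const_mul _)]
    refine integral_mono hixu.neg ((hiu.const_mul _).add (hif.const_mul _)) fun x => ?_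
    simp only
    by_cases hx : u x = 0
    · simp [hx]
    · have a1 := hs (subset_tsupport u hx)
      rw [mem_ball_zero_iff] at a1
      have a2 : |x i| ≤ 1 / 2 := by
        have := EuclideanSpace.norm_eq x
        have h := PiLp.norm_apply_le x i
        rw [Real.norm_eq_abs] at h
        linarith
      have a3 : |fderiv ℝ u x e| ≤ ‖fderiv ℝ u x‖ := by
        have := (fderiv ℝ u x).le_opNorm e
        simpa [he] using this
      have a4 : |x i * u x * fderiv ℝ u x e| ≤ (1 / 2) * |u x| * ‖fderiv ℝ u x‖ := by
        rw [abs_mul, abs_mul]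
        gcongr
      have a5 := neg_abs_le (x i * u x * fderiv ℝ u x e)
      have a6 := sq_nonneg (|u x| - ‖fderiv ℝ u x‖)
      have a7 := sq_abs (u x)
      nlinarith
  linarith

lemma bump_exists (d : ℕ) : ∃ u : EuclideanSpace ℝ (Fin d) → ℝ,
    ContDiff ℝ 2 u ∧ tsupport u ⊆ Metric.ball 0 (1 / 2) ∧ 0 < (∫ x, u x ^ 2) ∧ (∀ x, 0 ≤ u x) ∧
      0 < ∫ x, u x := by
  let f : ContDiffBump (0 : EuclideanSpace ℝ (Fin d)) := ⟨1 / 8, 1 / 4, by norm_num, by norm_num⟩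
  refine ⟨f, f.contDiff, ?_, ?_, fun x => f.nonneg, f.integral_pos⟩
  · rw [f.tsupport_eq]
    exact Metric.closedBall_subset_ball (by norm_num)
  · have hc : HasCompactSupport (fun x => f x ^ 2) := by
      simp only [pow_two]; exact f.hasCompactSupport.mul_left
    have hcont : Continuous (fun x => f x ^ 2) := f.continuous.pow 2
    refine hcont.integral_pos_of_hasCompactSupport_nonneg_nonzero hc (fun x => sq_nonneg _)
      (x := 0) ?_
    have : f 0 = 1 := f.one_of_mem_closedBall (by simp [f])
    simp [this]

lemma lambda_facts {d : ℕ} (i : Fin d) : 1 ≤ dirichletLambdaMin d ∧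
    ∃ u : EuclideanSpace ℝ (Fin d) → ℝ,
      ContDiff ℝ 2 u ∧ tsupport u ⊆ Metric.ball 0 (1 / 2) ∧
      (∫ x, ‖fderiv ℝ u x‖ ^ 2) < 2 * dirichletLambdaMin d * (∫ x, u x ^ 2) := by
  obtain ⟨u₀, h1, h2, h3, -, -⟩ := bump_exists d
  haveI : Nonempty {u : EuclideanSpace ℝ (Fin d) → ℝ //
      ContDiff ℝ 2 u ∧ tsupport u ⊆ Metric.ball 0 (1 / 2) ∧ (∫ x, u x ^ 2) ≠ 0} :=
    ⟨⟨u₀, h1, h2, h3.ne'⟩⟩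
  have hpos : ∀ u : EuclideanSpace ℝ (Fin d) → ℝ, (∫ x, u x ^ 2) ≠ 0 → 0 < (∫ x, u x ^ 2) :=
    fun u hu => lt_of_le_of_ne (integral_nonneg fun x => sq_nonneg _) hu.symm
  have hl : 1 ≤ dirichletLambdaMin d := by
    refine le_ciInf fun u => ?_
    rw [le_div_iff₀ (hpos _ u.2.2.2), one_mul]
    exact poincare i u.1 u.2.1 u.2.2.1
  refine ⟨hl, ?_⟩
  have hlt : dirichletLambdaMin d < 2 * dirichletLambdaMin d := by linarith
  obtain ⟨u, hu⟩ := exists_lt_of_ciInf_lt hlt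
  refine ⟨u.1, u.2.1, u.2.2.1, ?_⟩
  rwa [div_lt_iff₀ (hpos _ u.2.2.2)] at hu

lemma low_bound {d : ℕ} (u : EuclideanSpace ℝ (Fin d) → ℝ) (hu : ContDiff ℝ 2 u)
    (hs : tsupport u ⊆ Metric.ball 0 (1 / 2)) (ρ : ℝ) (hρ0 : 0 ≤ ρ)
    (hρ : (∫ x, ‖fderiv ℝ u x‖ ^ 2) < ρ ^ 2 * (∫ x, u x ^ 2)) :
    ∃ c : ℝ, 0 < c ∧ ∀ (n : ℕ) (y : Fin n → EuclideanSpace ℝ (Fin d)),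
      (∀ i j, i ≠ j → 1 ≤ dist (y i) (y j)) → ∀ β : Fin n → ℂ,
      c * ∑ j, ‖β j‖ ^ 2 ≤ ∫ ξ in Metric.ball 0 (ρ / (2 * Real.pi)),
        ‖∑ j, β j * Complex.exp (Complex.I * ((2 * Real.pi * ⟪ξ, y j⟫_ℝ : ℝ) : ℂ))‖ ^ 2 := by
  set κ := ρ ^ 2 * (∫ x, u x ^ 2) - (∫ x, ‖fderiv ℝ u x‖ ^ 2) with hκ
  have hκ0 : 0 < κ := by linarith
  set M := ∫ x, ‖(u x : ℂ)‖ with hM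
  have hM0 : 0 ≤ M := integral_nonneg fun x => norm_nonneg _
  have hD : 0 < ρ ^ 2 * M ^ 2 + 1 := by positivity
  refine ⟨κ / (ρ ^ 2 * M ^ 2 + 1), by positivity, fun n y hy β => ?_⟩
  set P : EuclideanSpace ℝ (Fin d) → ℝ := fun ξ =>
    ‖∑ j, β j * Complex.exp (Complex.I * ((2 * Real.pi * ⟪ξ, y j⟫_ℝ : ℝ) : ℂ))‖ ^ 2 with hP
  have hPc : Continuous P := by
    refine (Continuous.norm ?_).pow 2
    fun_prop
  have hP0 : ∀ ξ, 0 ≤ P ξ := fun ξ => sq_nonneg _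
  obtain ⟨i1, e1⟩ := key_one u hu.continuous hs y hy β
  obtain ⟨i2, e2⟩ := key_two u hu hs y hy β
  have hib : IntegrableOn P (Metric.ball 0 (ρ / (2 * Real.pi))) :=
    (hPc.continuousOn.integrableOn_compact
      (isCompact_closedBall 0 (ρ / (2 * Real.pi)))).mono_set Metric.ball_subset_closedBall
  rw [div_mul_eq_mul_div, div_le_iff₀ hD]
  have hpt : ∀ ξ, ρ ^ 2 * (‖𝓕 (fun x => (u x : ℂ)) ξ‖ ^ 2 * P ξ) -
      (2 * Real.pi * ‖ξ‖) ^ 2 * (‖𝓕 (fun x => (u x : ℂ)) ξ‖ ^ 2 * P ξ) ≤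
      (Metric.ball 0 (ρ / (2 * Real.pi))).indicator (fun ξ => P ξ * (ρ ^ 2 * M ^ 2 + 1)) ξ := by
    intro ξ
    have hb : ‖𝓕 (fun x => (u x : ℂ)) ξ‖ ≤ M :=
      VectorFourier.norm_fourierIntegral_le_integral_norm _ _ _ _ _
    have hb2 : ‖𝓕 (fun x => (u x : ℂ)) ξ‖ ^ 2 ≤ M ^ 2 := by gcongr
    have hW : 0 ≤ ‖𝓕 (fun x => (u x : ℂ)) ξ‖ ^ 2 * P ξ := mul_nonneg (sq_nonneg _) (hP0 ξ)
    by_cases hξ : ξ ∈ Metric.ball (0 : EuclideanSpace ℝ (Fin d)) (ρ / (2 * Real.pi))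
    · rw [Set.indicator_of_mem hξ]
      have h1 : ‖𝓕 (fun x => (u x : ℂ)) ξ‖ ^ 2 * P ξ ≤ M ^ 2 * P ξ :=
        mul_le_mul_of_nonneg_right hb2 (hP0 ξ)
      have h2 := mul_le_mul_of_nonneg_left h1 (sq_nonneg ρ)
      have h3 := mul_nonneg (sq_nonneg (2 * Real.pi * ‖ξ‖)) hW
      nlinarith [hP0 ξ]
    · rw [Set.indicator_of_notMem hξ]
      rw [mem_ball_zero_iff, not_lt, div_le_iff₀ (by positivity)] at hξ
      have : ρ ^ 2 ≤ (2 * Real.pi * ‖ξ‖) ^ 2 := by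
        apply pow_le_pow_left₀ hρ0; linarith
      nlinarith
  have hint := integral_mono ((i1.const_mul (ρ ^ 2)).sub i2)
    (IntegrableOn.integrable_indicator (hib.mul_const _) measurableSet_ball) hpt
  rw [integral_indicator measurableSet_ball, integral_mul_const] at hint
  simp only [Pi.sub_apply] at hint
  rw [integral_sub (i1.const_mul (ρ ^ 2)) i2, integral_const_mul, e1, e2] at hint
  rw [hκ]; linarith

lemma up_bound (d : ℕ) :
    ∃ C : ℝ, 0 < C ∧ ∀ (n : ℕ) (y : Fin n → EuclideanSpace ℝ (Fin d)),
      (∀ i j, i ≠ j → 1 ≤ dist (y i) (y j)) → ∀ β : Fin n → ℂ,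
      (∫ ξ in Metric.ball 0 (1 / (2 * Real.pi)),
        ‖∑ j, β j * Complex.exp (Complex.I * ((2 * Real.pi * ⟪ξ, y j⟫_ℝ : ℝ) : ℂ))‖ ^ 2) ≤
      C * ∑ j, ‖β j‖ ^ 2 := by
  obtain ⟨u, hu, hs, hpos, hnn, hI⟩ := bump_exists d
  set I := ∫ x, u x with hIdef
  have hc : HasCompactSupport u :=
    HasCompactSupport.of_support_subset_isCompact (isCompact_closedBall 0 (1 / 2))
      ((subset_tsupport u).trans (hs.trans Metric.ball_subset_closedBall))
  have hui : Integrable u := hu.continuous.integrable_of_hasCompactSupport hc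
  refine ⟨((I / 2) ^ 2)⁻¹ * (∫ x, u x ^ 2), by positivity, fun n y hy β => ?_⟩
  set P : EuclideanSpace ℝ (Fin d) → ℝ := fun ξ =>
    ‖∑ j, β j * Complex.exp (Complex.I * ((2 * Real.pi * ⟪ξ, y j⟫_ℝ : ℝ) : ℂ))‖ ^ 2 with hP
  have hPc : Continuous P := by
    refine (Continuous.norm ?_).pow 2
    fun_prop
  have hP0 : ∀ ξ, 0 ≤ P ξ := fun ξ => sq_nonneg _
  obtain ⟨i1, e1⟩ := key_one u hu.continuous hs y hy β
  have hib : IntegrableOn P (Metric.ball 0 (1 / (2 * Real.pi))) :=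
    (hPc.continuousOn.integrableOn_compact
      (isCompact_closedBall 0 (1 / (2 * Real.pi)))).mono_set Metric.ball_subset_closedBall
  have hlow : ∀ ξ ∈ Metric.ball (0 : EuclideanSpace ℝ (Fin d)) (1 / (2 * Real.pi)),
      I / 2 ≤ ‖𝓕 (fun x => (u x : ℂ)) ξ‖ := by
    intro ξ hξ
    rw [mem_ball_zero_iff, lt_div_iff₀ (by positivity)] at hξ
    refine le_trans ?_ (Complex.re_le_norm _)
    have hi : Integrable (fun v : EuclideanSpace ℝ (Fin d) =>
        Complex.exp ((↑(-2 * Real.pi * ⟪v, ξ⟫_ℝ) * Complex.I)) • (u v : ℂ)) := by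
      refine Continuous.integrable_of_hasCompactSupport ?_ ?_
      · have := hu.continuous; fun_prop
      · exact (hc.comp_left (g := fun x : ℝ => (x : ℂ)) (by simp)).mul_left
    have hre := Complex.reCLM.integral_comp_comm hi
    rw [Real.fourier_eq']
    refine le_trans ?_ (le_of_eq hre)
    rw [hIdef, ← integral_div]
    refine integral_mono (hui.div_const 2) (Complex.reCLM.integrable_comp hi) fun v => ?_
    have e : Complex.reCLM (Complex.exp ((↑(-2 * Real.pi * ⟪v, ξ⟫_ℝ) * Complex.I)) • (u v : ℂ))
        = Real.cos (-2 * Real.pi * ⟪v, ξ⟫_ℝ) * u v := by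
      rw [smul_eq_mul, Complex.reCLM_apply, Complex.re_mul_ofReal, Complex.exp_ofReal_mul_I_re]
    simp only [e]
    by_cases hv : u v = 0
    · simp [hv]
    · have a1 := hs (subset_tsupport u hv)
      rw [mem_ball_zero_iff] at a1
      have a2 := abs_real_inner_le_norm v ξ
      have a3 : |(-2 * Real.pi * ⟪v, ξ⟫_ℝ)| ≤ 1 := by
        have : |(-2 * Real.pi * ⟪v, ξ⟫_ℝ)| = (2 * Real.pi) * |⟪v, ξ⟫_ℝ| := by
          rw [abs_mul, abs_mul, abs_of_pos Real.pi_pos]; norm_num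
        rw [this]
        have h4 : |⟪v, ξ⟫_ℝ| ≤ 1 * ‖ξ‖ := a2.trans (by gcongr; linarith)
        have h5 := mul_le_mul_of_nonneg_left h4 (by positivity : 0 ≤ 2 * Real.pi)
        linarith
      have a4 := Real.one_sub_sq_div_two_le_cos (x := -2 * Real.pi * ⟪v, ξ⟫_ℝ)
      have a5 : (-2 * Real.pi * ⟪v, ξ⟫_ℝ) ^ 2 ≤ 1 := (sq_le_one_iff_abs_le_one _).2 a3
      have a6 : 1 / 2 ≤ Real.cos (-2 * Real.pi * ⟪v, ξ⟫_ℝ) := by linarith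
      have := mul_le_mul_of_nonneg_right a6 (hnn v)
      linarith
  have hpt : ∀ ξ, (Metric.ball 0 (1 / (2 * Real.pi))).indicator P ξ ≤
      ((I / 2) ^ 2)⁻¹ * (‖𝓕 (fun x => (u x : ℂ)) ξ‖ ^ 2 * P ξ) := by
    intro ξ
    have hW : 0 ≤ ‖𝓕 (fun x => (u x : ℂ)) ξ‖ ^ 2 * P ξ := mul_nonneg (sq_nonneg _) (hP0 ξ)
    by_cases hξ : ξ ∈ Metric.ball (0 : EuclideanSpace ℝ (Fin d)) (1 / (2 * Real.pi))
    · rw [Set.indicator_of_mem hξ, inv_mul_eq_div, le_div_iff₀ (by positivity), mul_comm]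
      have := hlow ξ hξ
      gcongr
    · rw [Set.indicator_of_notMem hξ]
      positivity
  have hint := integral_mono (hib.integrable_indicator measurableSet_ball)
    (i1.const_mul ((I / 2) ^ 2)⁻¹) hpt
  rw [integral_indicator measurableSet_ball, integral_const_mul, e1] at hint
  linarith

lemma change_var {d n : ℕ} (x : Fin n → EuclideanSpace ℝ (Fin d)) (R t : ℝ) (ht : 0 < t)
    (x₀ : EuclideanSpace ℝ (Fin d)) (α : Fin n → ℝ) :
    ∃ β : Fin n → ℂ, (∀ j, ‖β j‖ ^ 2 = α j ^ 2) ∧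
    (∫ ω in Metric.ball x₀ R,
      ‖∑ j, (α j : ℂ) * Complex.exp (Complex.I * ((⟪ω, x j⟫_ℝ : ℝ) : ℂ))‖ ^ 2) =
    (2 * Real.pi * t) ^ d * ∫ ξ in Metric.ball 0 (R / (2 * Real.pi * t)),
      ‖∑ j, β j * Complex.exp (Complex.I * ((2 * Real.pi * ⟪ξ, t • x j⟫_ℝ : ℝ) : ℂ))‖ ^ 2 := by
  refine ⟨fun j => (α j : ℂ) * Complex.exp (Complex.I * ((⟪x₀, x j⟫_ℝ : ℝ) : ℂ)), fun j => ?_, ?_⟩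
  · rw [norm_mul, mul_comm Complex.I, Complex.norm_exp_ofReal_mul_I]; simp
  set s := 2 * Real.pi * t with hsdef
  have hs0 : 0 < s := by positivity
  rw [← integral_indicator measurableSet_ball, ← integral_indicator measurableSet_ball]
  set G := (Metric.ball x₀ R).indicator (fun ω =>
      ‖∑ j, (α j : ℂ) * Complex.exp (Complex.I * ((⟪ω, x j⟫_ℝ : ℝ) : ℂ))‖ ^ 2) with hG
  have h1 : ∫ ω, G ω = ∫ ω, G (x₀ + ω) := (integral_add_left_eq_self G x₀).symm
  have h2 := Measure.integral_comp_smul_of_nonneg (volume : Measure (EuclideanSpace ℝ (Fin d)))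
    (fun ω => G (x₀ + ω)) s (hR := hs0.le)
  rw [finrank_euclideanSpace_fin, smul_eq_mul] at h2
  have h3 : ∫ ω, G ω = s ^ d * ∫ ξ, G (x₀ + s • ξ) := by
    rw [h2, h1, ← mul_assoc, mul_inv_cancel₀ (by positivity), one_mul]
  rw [h3]
  congr 2
  ext ξ
  have hmem : x₀ + s • ξ ∈ Metric.ball x₀ R ↔
      ξ ∈ Metric.ball (0 : EuclideanSpace ℝ (Fin d)) (R / s) := by
    rw [mem_ball_iff_norm, mem_ball_zero_iff, add_sub_cancel_left, norm_smul,
      Real.norm_of_nonneg hs0.le, lt_div_iff₀ hs0, mul_comm]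
  by_cases hξ : ξ ∈ Metric.ball (0 : EuclideanSpace ℝ (Fin d)) (R / s)
  · rw [Set.indicator_of_mem hξ, hG, Set.indicator_of_mem (hmem.2 hξ)]
    congr 2
    refine Finset.sum_congr rfl fun j _ => ?_
    rw [mul_assoc, ← Complex.exp_add, inner_add_left, real_inner_smul_left, real_inner_smul_right]
    congr 2
    rw [hsdef]; push_cast; ring
  · rw [Set.indicator_of_notMem hξ, hG, Set.indicator_of_notMem (fun h => hξ (hmem.1 h))]

/-- Refined multivariate Ingham-type theorem, with explicit dependence on the
radius `R` of the ball. -/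
theorem stmt_3 (d : ℕ) :
    ∃ c₁ c₂ : ℝ, 0 < c₁ ∧ 0 < c₂ ∧
      ∀ (n : ℕ) (x : Fin n → EuclideanSpace ℝ (Fin d)), Function.Injective x →
        ∀ qX : ℝ, IsLeast {r | ∃ i j, i ≠ j ∧ r = dist (x i) (x j)} qX →
        ∀ (R : ℝ) (x₀ : EuclideanSpace ℝ (Fin d)) (α : Fin n → ℝ),
        (Real.sqrt 2 * Real.sqrt (dirichletLambdaMin d) / qX ≤ R →
          c₁ * R ^ d * ∑ j, α j ^ 2 ≤
              ∫ ω in Metric.ball x₀ R,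
                ‖∑ j, (α j : ℂ) * Complex.exp (Complex.I * ((⟪ω, x j⟫_ℝ : ℝ) : ℂ))‖ ^ 2 ∧
            (∫ ω in Metric.ball x₀ R,
                ‖∑ j, (α j : ℂ) * Complex.exp (Complex.I * ((⟪ω, x j⟫_ℝ : ℝ) : ℂ))‖ ^ 2) ≤
              c₂ * R ^ d * ∑ j, α j ^ 2) ∧
        (Real.pi / qX ≤ R →
          (∫ ω in Metric.ball x₀ R,
              ‖∑ j, (α j : ℂ) * Complex.exp (Complex.I * ((⟪ω, x j⟫_ℝ : ℝ) : ℂ))‖ ^ 2) ≤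
            c₂ * R ^ d * ∑ j, α j ^ 2) := by
  rcases Nat.eq_zero_or_pos d with hd | hd
  · subst hd
    refine ⟨1, 1, one_pos, one_pos, fun n x hx qX hq => ?_⟩
    obtain ⟨i, j, hij, -⟩ := hq.1
    exact absurd (hx (Subsingleton.elim _ _)) hij
  obtain ⟨hl, u, hu, hs, hlt⟩ := lambda_facts (⟨0, hd⟩ : Fin d)
  set ρ := Real.sqrt 2 * Real.sqrt (dirichletLambdaMin d) with hρ
  have hρ2 : ρ ^ 2 = 2 * dirichletLambdaMin d := by
    rw [hρ, mul_pow, Real.sq_sqrt (by norm_num), Real.sq_sqrt (by linarith)]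
  have hρ0 : 0 ≤ ρ := by positivity
  have hρ1 : 1 ≤ ρ := by nlinarith
  obtain ⟨c, hc, hlow⟩ := low_bound u hu hs ρ hρ0 (by rw [hρ2]; exact hlt)
  obtain ⟨C, hC, hup⟩ := up_bound d
  refine ⟨(2 * Real.pi / ρ) ^ d * c, (2 * Real.pi) ^ d * C, by positivity, by positivity,
    fun n x hx qX hq R x₀ α => ?_⟩
  have hqpos : 0 < qX := by
    obtain ⟨i, j, hij, h⟩ := hq.1
    rw [h]
    exact dist_pos.2 fun h => hij (hx h)
  have hsep : ∀ t : ℝ, 1 / qX ≤ t → ∀ i j, i ≠ j → 1 ≤ dist (t • x i) (t • x j) := by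
    intro t ht i j hij
    have h1 : qX ≤ dist (x i) (x j) := hq.2 ⟨i, j, hij, rfl⟩
    have ht0 : 0 < t := lt_of_lt_of_le (by positivity) ht
    rw [dist_smul₀, Real.norm_of_nonneg ht0.le]
    rw [div_le_iff₀ hqpos] at ht
    exact ht.trans (by gcongr)
  have hU : 1 / qX ≤ R → (∫ ω in Metric.ball x₀ R,
              ‖∑ j, (α j : ℂ) * Complex.exp (Complex.I * ((⟪ω, x j⟫_ℝ : ℝ) : ℂ))‖ ^ 2) ≤
            (2 * Real.pi) ^ d * C * R ^ d * ∑ j, α j ^ 2 := by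
    intro hR
    have hR0 : 0 < R := lt_of_lt_of_le (by positivity) hR
    obtain ⟨β, hβ, e⟩ := change_var x R R hR0 x₀ α
    have h := hup n (fun j => R • x j) (hsep R hR) β
    have hr : R / (2 * Real.pi * R) = 1 / (2 * Real.pi) := by field_simp
    rw [e, hr]
    simp only [hβ] at h
    calc _ ≤ (2 * Real.pi * R) ^ d * (C * ∑ j, α j ^ 2) := by gcongr
      _ = _ := by rw [mul_pow]; ring
  refine ⟨fun hR => ⟨?_, hU (le_trans (by gcongr) hR)⟩, fun hR => hU (le_trans ?_ hR)⟩
  · have hR0 : 0 < R := lt_of_lt_of_le (by positivity) hR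
    have ht0 : 0 < R / ρ := by positivity
    obtain ⟨β, hβ, e⟩ := change_var x R (R / ρ) ht0 x₀ α
    have hq1 : 1 / qX ≤ R / ρ := by
      rw [le_div_iff₀ (by positivity)]
      calc _ = ρ / qX := by ring
        _ ≤ R := hR
    have h := hlow n (fun j => (R / ρ) • x j) (hsep _ hq1) β
    have hr : R / (2 * Real.pi * (R / ρ)) = ρ / (2 * Real.pi) := by field_simp
    rw [e, hr]
    simp only [hβ] at h
    calc _ = (2 * Real.pi * (R / ρ)) ^ d * (c * ∑ j, α j ^ 2) := by
          simp only [mul_pow, div_pow]; ring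
      _ ≤ _ := by gcongr
  · have := Real.pi_gt_three
    gcongr
    linarith
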